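/- Let c₁, c₂ ∈ ℂ, let h ≥ 1 and d₁ ≥ 1 be integers, p ∈ ℤ, and set g = gcd(h, p) (with g = h if p = 0). Let S be the exp(−2π√−1·c₂)-twisted cyclic shift matrix of size h over ℂ, let K = exp(2π√−1·c₁)·S^p, and let L = L(K, d₁) be the block companion matrix of K of block size d₁. Then the characteristic polynomial of L equals ( X^{h·d₁/g} − exp(2π√−1·(h·c₁ − p·c₂)/g) )^{g}. (With the primitive inner conormal ρ₁₁ = (−h/g, p/g) ∈ ℤ², lattice height h₁₁ = h·d₁/g and Vol_ℤ(Γ̂₁₁) = g, this is the factor (t^{h₁₁} − exp(−2π√−1⟨ρ₁₁,c⟩))^{Vol_ℤ(Γ̂₁₁)} of the monodromy at infinity of the confluent A-hypergeometric functions in the two-dimensional case.) -/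

import Mathlib

/-- The `ε`-twisted cyclic shift matrix of size `h`: entry `(i,j)` is `1` if `i = j + 1`,
`ε` if `i = 0` and `j = h - 1`, and `0` otherwise. -/
def twistedShift (R : Type*) [CommRing R] (h : ℕ) (ε : R) : Matrix (Fin h) (Fin h) R :=
  Matrix.of fun i j =>
    if (i : ℕ) = (j : ℕ) + 1 then 1
    else if (i : ℕ) = 0 ∧ (j : ℕ) = h - 1 then ε
    else 0

/-- The block companion matrix `L(A, d)` of an `h × h` matrix `A` with block size `d`:
a `d × d` array of `h × h` blocks whose top-right block is `A`, whose block-subdiagonal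
blocks are the identity, and whose other blocks are zero. -/
def blockCompanion (R : Type*) [CommRing R] (h d : ℕ) (A : Matrix (Fin h) (Fin h) R) :
    Matrix (Fin d × Fin h) (Fin d × Fin h) R :=
  Matrix.of fun p q =>
    if (p.1 : ℕ) = (q.1 : ℕ) + 1 then (if p.2 = q.2 then 1 else 0)
    else if (p.1 : ℕ) = 0 ∧ (q.1 : ℕ) = d - 1 then A p.2 q.2
    else 0

/-- If `Q` is invertible and intertwines `A` and `B`, their characteristic polynomials agree. -/
theorem charpoly_eq_of_mul_eq_mul {R n : Type*} [CommRing R] [Fintype n] [DecidableEq n]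
    {Q A B : Matrix n n R} (hQ : IsUnit Q) (h : Q * A = B * Q) : A.charpoly = B.charpoly := by
  obtain ⟨u, rfl⟩ := hQ
  have hB : B = u.val * A * u⁻¹.val := by rw [h, mul_assoc, Units.mul_inv, mul_one]
  rw [hB, Matrix.coe_units_inv]
  exact (Matrix.charpoly_units_conj u A).symm

/-- A diagonalization of the `α ^ h`-twisted cyclic shift. -/
theorem exists_isUnit_mul_diagonal_eq_twistedShift_mul {K : Type*} [Field K] {h : ℕ} (hh : 1 ≤ h)
    {ζ α : K} (hζ : IsPrimitiveRoot ζ h) (hα : α ≠ 0) :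
    ∃ P : Matrix (Fin h) (Fin h) K, IsUnit P ∧
      P * Matrix.diagonal (fun k : Fin h => ζ ^ (k : ℕ) * α) = twistedShift K h (α ^ h) * P := by
  have hζ0 : ζ ≠ 0 := hζ.ne_zero (by omega)
  let v : Fin h → K := fun k => (ζ ^ (k : ℕ) * α)⁻¹
  have hv0 : ∀ k, ζ ^ ((k : Fin h) : ℕ) * α ≠ 0 := fun k => mul_ne_zero (pow_ne_zero _ hζ0) hα
  have hv : Function.Injective v := by
    intro a b hab
    have h1 := mul_right_cancel₀ hα (inv_injective hab)
    exact Fin.ext (hζ.pow_inj a.2 b.2 h1)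
  refine ⟨(Matrix.vandermonde v).transpose, ?_, ?_⟩
  · rw [Matrix.isUnit_iff_isUnit_det, Matrix.det_transpose, isUnit_iff_ne_zero]
    exact Matrix.det_vandermonde_ne_zero_iff.2 hv
  · ext i k
    rw [Matrix.mul_diagonal, Matrix.mul_apply, Matrix.transpose_apply, Matrix.vandermonde_apply]
    rcases Nat.eq_zero_or_pos (i : ℕ) with hi | hi
    · rw [Finset.sum_eq_single (⟨h - 1, by omega⟩ : Fin h)]
      · have hp : (ζ ^ (k : ℕ) * α) ^ h = α ^ h := by
          rw [mul_pow, ← pow_mul, mul_comm (k : ℕ), pow_mul, hζ.pow_eq_one, one_pow, one_mul]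
        obtain ⟨m, rfl⟩ : ∃ m, h = m + 1 := ⟨h - 1, by omega⟩
        simp only [twistedShift, Matrix.of_apply, Matrix.transpose_apply,
          Matrix.vandermonde_apply, hi, v]
        have := hv0 k
        rw [← hp]
        generalize ζ ^ (k : ℕ) * α = μ at this ⊢
        rw [if_neg (by omega), if_pos (by simp), Nat.add_sub_cancel, pow_zero, one_mul, inv_pow,
          pow_succ', mul_inv_cancel_right₀ (pow_ne_zero _ this)]
      · intro j _ hj
        have : (j : ℕ) ≠ h - 1 := fun e => hj (Fin.ext e)
        simp [twistedShift, hi, this]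
      · simp
    · rw [Finset.sum_eq_single (⟨i - 1, by omega⟩ : Fin h)]
      · have hi' : (i : ℕ) = (i : ℕ) - 1 + 1 := by omega
        simp only [twistedShift, Matrix.of_apply, Matrix.transpose_apply,
          Matrix.vandermonde_apply, v, if_pos hi', one_mul]
        have := hv0 k
        conv_lhs => rw [hi', pow_succ]
        field_simp
      · intro j _ hj
        have h1 : (i : ℕ) ≠ (j : ℕ) + 1 := fun e => hj (Fin.ext (by simp [e]))
        simp [twistedShift, hi.ne', h1]
      · simp

open Polynomial in
theorem charpoly_twistedShift_pow {K : Type*} [Field K] {h : ℕ} (hh : 1 ≤ h)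
    {ζ α : K} (hζ : IsPrimitiveRoot ζ h) (hα : α ≠ 0) :
    (twistedShift K h (α ^ h)).charpoly = X ^ h - C (α ^ h) := by
  obtain ⟨P, hP, hPS⟩ := exists_isUnit_mul_diagonal_eq_twistedShift_mul hh hζ hα
  rw [← charpoly_eq_of_mul_eq_mul hP hPS, Matrix.charpoly_diagonal,
    X_pow_sub_C_eq_prod hζ hh rfl, Finset.prod_range]

open Polynomial in
theorem charpoly_twistedShift_complex {h : ℕ} (hh : 1 ≤ h) {ε : ℂ} (hε : ε ≠ 0) :
    (twistedShift ℂ h ε).charpoly = X ^ h - C ε := by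
  obtain ⟨α, rfl⟩ := IsAlgClosed.exists_pow_nat_eq ε (n := h) hh
  exact charpoly_twistedShift_pow hh (Complex.isPrimitiveRoot_exp h (by omega))
    (by rintro rfl; exact hε (zero_pow (by omega)))

open Kronecker in
theorem blockCompanion_eq_kronecker (R : Type*) [CommRing R] (h d : ℕ)
    (A : Matrix (Fin h) (Fin h) R) :
    blockCompanion R h d A = twistedShift R d 0 ⊗ₖ (1 : Matrix (Fin h) (Fin h) R) +
      (twistedShift R d 1 - twistedShift R d 0) ⊗ₖ A := by
  ext ⟨a, i⟩ ⟨b, j⟩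
  simp only [blockCompanion, twistedShift, Matrix.of_apply, Matrix.add_apply,
    Matrix.kroneckerMap_apply, Matrix.sub_apply, Matrix.one_apply]
  split_ifs <;> simp

open Kronecker in
theorem charpoly_blockCompanion_congr {R : Type*} [CommRing R] {h d : ℕ}
    {P A B : Matrix (Fin h) (Fin h) R} (hP : IsUnit P) (hPA : P * A = B * P) :
    (blockCompanion R h d A).charpoly = (blockCompanion R h d B).charpoly := by
  have hQ : IsUnit ((1 : Matrix (Fin d) (Fin d) R) ⊗ₖ P) := by
    rw [Matrix.isUnit_iff_isUnit_det, Matrix.det_kronecker, Matrix.det_one, one_pow, one_mul]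
    exact ((Matrix.isUnit_iff_isUnit_det P).1 hP).pow _
  refine charpoly_eq_of_mul_eq_mul hQ ?_
  simp only [blockCompanion_eq_kronecker, mul_add, add_mul, ← Matrix.mul_kronecker_mul,
    one_mul, mul_one, hPA]

theorem blockCompanion_diagonal (R : Type*) [CommRing R] (h d : ℕ) (κ : Fin h → R) :
    blockCompanion R h d (Matrix.diagonal κ) =
      Matrix.blockDiagonal (fun k => twistedShift R d (κ k)) := by
  ext ⟨a, i⟩ ⟨b, j⟩
  simp only [blockCompanion, twistedShift, Matrix.of_apply, Matrix.blockDiagonal_apply,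
    Matrix.diagonal_apply]
  split_ifs <;> rfl

theorem charmatrix_blockDiagonal {R n o : Type*} [CommRing R] [Fintype n] [DecidableEq n]
    [Fintype o] [DecidableEq o] (M : o → Matrix n n R) :
    (Matrix.blockDiagonal M).charmatrix = Matrix.blockDiagonal fun k => (M k).charmatrix := by
  ext1 ⟨a, i⟩ ⟨b, j⟩
  simp only [Matrix.charmatrix_apply, Matrix.blockDiagonal_apply, Matrix.diagonal_apply,
    Prod.mk.injEq]
  by_cases hij : i = j <;> simp [hij]

theorem charpoly_blockDiagonal {R n o : Type*} [CommRing R] [Fintype n] [DecidableEq n]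
    [Fintype o] [DecidableEq o] (M : o → Matrix n n R) :
    (Matrix.blockDiagonal M).charpoly = ∏ k, (M k).charpoly := by
  simp only [Matrix.charpoly, charmatrix_blockDiagonal, Matrix.det_blockDiagonal]

open Polynomial in
theorem charpoly_blockCompanion_diagonal {h d : ℕ} (hd : 1 ≤ d) {κ : Fin h → ℂ}
    (hκ : ∀ k, κ k ≠ 0) :
    (blockCompanion ℂ h d (Matrix.diagonal κ)).charpoly = ∏ k, (X ^ d - C (κ k)) := by
  rw [blockCompanion_diagonal, charpoly_blockDiagonal]
  exact Finset.prod_congr rfl fun k _ => charpoly_twistedShift_complex hd (hκ k)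

theorem diagonal_zpow_of_ne_zero {K n : Type*} [Field K] [Fintype n] [DecidableEq n] {v : n → K}
    (hv : ∀ k, v k ≠ 0) (p : ℤ) :
    Matrix.diagonal v ^ p = Matrix.diagonal fun k => v k ^ p := by
  have hinv : ∀ w : n → K, (∀ k, w k ≠ 0) →
      (Matrix.diagonal w)⁻¹ = Matrix.diagonal fun k => (w k)⁻¹ := by
    intro w hw
    refine Matrix.inv_eq_left_inv ?_
    simp [Matrix.diagonal_mul_diagonal, hw]
  cases p with
  | ofNat m =>
    simp only [Int.ofNat_eq_natCast, zpow_natCast, Matrix.diagonal_pow]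
    rfl
  | negSucc m =>
    simp only [zpow_negSucc, Matrix.diagonal_pow]
    exact hinv _ fun k => pow_ne_zero _ (hv k)

theorem prod_range_mul_of_pow_eq_one {K M : Type*} [Monoid K] [CommMonoid M] {ω : K} {m : ℕ}
    (hω : ω ^ m = 1) (f : K → M) (g : ℕ) :
    ∏ k ∈ Finset.range (g * m), f (ω ^ k) = (∏ k ∈ Finset.range m, f (ω ^ k)) ^ g := by
  induction g with
  | zero => simp
  | succ g ih =>
    rw [Nat.succ_mul, Finset.prod_range_add, ih, pow_succ]
    simp [pow_add, mul_comm g m, pow_mul, hω]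

theorem IsPrimitiveRoot.zpow_div_gcd {K : Type*} [Field K] {ζ : K} {h : ℕ} (hh : 1 ≤ h)
    (hζ : IsPrimitiveRoot ζ h) (p : ℤ) :
    IsPrimitiveRoot (ζ ^ p) (h / Int.gcd h p) := by
  have hg : 0 < Int.gcd (h : ℤ) p := Int.gcd_pos_of_ne_zero_left _ (by omega)
  have hgh : Int.gcd (h : ℤ) p ∣ h := by
    exact_mod_cast Int.gcd_dvd_left (h : ℤ) p
  have h1 := hζ.pow hh (Nat.mul_div_cancel' hgh).symm
  have h2 := h1.zpow_of_gcd_eq_one (p / Int.gcd (h : ℤ) p) (by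
    rw [Int.gcd_comm, Int.natCast_div]
    exact Int.gcd_div_gcd_div_gcd hg)
  rwa [← zpow_natCast, ← zpow_mul, Int.mul_ediv_cancel' (Int.gcd_dvd_right _ _)] at h2

open Polynomial in
/-- The characteristic polynomial of the block companion matrix of `κ • S ^ p`, for `S` the
`α ^ h`-twisted cyclic shift. -/
theorem charpoly_blockCompanion_smul_twistedShift_zpow {h d : ℕ} (hh : 1 ≤ h) (hd : 1 ≤ d)
    {κ α : ℂ} (hκ : κ ≠ 0) (hα : α ≠ 0) (p : ℤ) :
    (blockCompanion ℂ h d (κ • twistedShift ℂ h (α ^ h) ^ p)).charpoly =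
      (X ^ (h * d / Int.gcd h p) - C ((κ * α ^ p) ^ (h / Int.gcd h p))) ^ Int.gcd h p := by
  have hζ : IsPrimitiveRoot (Complex.exp (2 * Real.pi * Complex.I / h)) h :=
    Complex.isPrimitiveRoot_exp h (by omega)
  generalize Complex.exp (2 * Real.pi * Complex.I / h) = ζ at hζ
  have hζ0 : ζ ≠ 0 := hζ.ne_zero (by omega)
  obtain ⟨P, hP, hPS⟩ := exists_isUnit_mul_diagonal_eq_twistedShift_mul hh hζ hα
  have hv : ∀ k : Fin h, ζ ^ (k : ℕ) * α ≠ 0 := fun k => mul_ne_zero (pow_ne_zero _ hζ0) hα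
  have hD : IsUnit (Matrix.diagonal fun k : Fin h => ζ ^ (k : ℕ) * α).det := by
    rw [Matrix.det_diagonal, isUnit_iff_ne_zero]
    exact Finset.prod_ne_zero_iff.2 fun k _ => hv k
  have hPd := (Matrix.isUnit_iff_isUnit_det P).1 hP
  have hS : IsUnit (twistedShift ℂ h (α ^ h)).det := by
    have := congrArg Matrix.det hPS
    rw [Matrix.det_mul, Matrix.det_mul] at this
    exact isUnit_of_mul_isUnit_left (this ▸ hPd.mul hD)
  have hpow := Matrix.SemiconjBy.zpow_right hD hS hPS p
  rw [diagonal_zpow_of_ne_zero hv] at hpow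
  have hconj : P * (κ • Matrix.diagonal fun k : Fin h => (ζ ^ (k : ℕ) * α) ^ p) =
      (κ • twistedShift ℂ h (α ^ h) ^ p) * P := by
    rw [Matrix.mul_smul, Matrix.smul_mul, hpow.eq]
  rw [← charpoly_blockCompanion_congr hP hconj, ← Matrix.diagonal_smul,
    charpoly_blockCompanion_diagonal hd fun k => by
      simpa using ⟨hκ, zpow_ne_zero p (hv k)⟩]
  have hω := hζ.zpow_div_gcd hh p
  have hg : 0 < Int.gcd (h : ℤ) p := Int.gcd_pos_of_ne_zero_left _ (by omega)
  have hgh : Int.gcd (h : ℤ) p ∣ h := by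
    exact_mod_cast Int.gcd_dvd_left (h : ℤ) p
  generalize Int.gcd (h : ℤ) p = g at *
  obtain ⟨m, rfl⟩ := hgh
  rw [Nat.mul_div_cancel_left _ hg] at *
  rw [mul_assoc, Nat.mul_div_cancel_left _ hg]
  have hm : 0 < m := Nat.pos_of_ne_zero (by rintro rfl; simp at hh)
  have hfac := congrArg (fun q : ℂ[X] => q.comp (X ^ d))
    (X_pow_sub_C_eq_prod hω hm (rfl : (κ * α ^ p) ^ m = _))
  simp only [sub_comp, pow_comp, X_comp, C_comp, prod_comp] at hfac
  rw [mul_comm m d, pow_mul, hfac,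
    ← prod_range_mul_of_pow_eq_one hω.pow_eq_one (fun z => (X ^ d - C (z * (κ * α ^ p)) : ℂ[X])),
    Finset.prod_range]
  refine Finset.prod_congr rfl fun k _ => ?_
  congr 2
  simp only [Pi.smul_apply, smul_eq_mul]
  rw [mul_zpow, ← zpow_natCast, ← zpow_natCast, ← zpow_mul, ← zpow_mul, mul_comm p]
  ring

/-- with `S` the `exp(-2π√-1 c₂)`-twisted cyclic shift matrix of size `h`,
`K = exp(2π√-1 c₁) • S^p`, `L = L(K, d₁)` and `g = gcd(h, p)`, the characteristic
polynomial of `L` equals `(X^{h d₁/g} - exp(2π√-1 (h c₁ - p c₂)/g))^g`. This is the factor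
`(t^{h₁₁} - exp(-2π√-1 ⟨ρ₁₁, c⟩))^{Vol_ℤ(Γ̂₁₁)}` of the monodromy at infinity of the
confluent `A`-hypergeometric functions in the two-dimensional case. -/
theorem stmt_9 (c₁ c₂ : ℂ) (h d₁ : ℕ) (hh : 1 ≤ h) (hd : 1 ≤ d₁) (p : ℤ) (g : ℕ)
    (hg : g = Int.gcd (h : ℤ) p) :
    (blockCompanion ℂ h d₁
        (Complex.exp (2 * (Real.pi : ℂ) * Complex.I * c₁) •
          (twistedShift ℂ h (Complex.exp (-(2 * (Real.pi : ℂ) * Complex.I * c₂))) ^ p))).charpoly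
      = (Polynomial.X ^ (h * d₁ / g) -
          Polynomial.C (Complex.exp (2 * (Real.pi : ℂ) * Complex.I *
            ((h : ℂ) * c₁ - (p : ℂ) * c₂) / (g : ℂ)))) ^ g := by
  subst hg
  have hh0 : (h : ℂ) ≠ 0 := by exact_mod_cast (by omega : h ≠ 0)
  have hε : Complex.exp (-(2 * (Real.pi : ℂ) * Complex.I * c₂)) =
      Complex.exp (-(2 * (Real.pi : ℂ) * Complex.I * c₂) / h) ^ h := by
    rw [← Complex.exp_nat_mul, mul_div_cancel₀ _ hh0]
  have hg : 0 < Int.gcd (h : ℤ) p := Int.gcd_pos_of_ne_zero_left _ (by omega)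
  have hgh : Int.gcd (h : ℤ) p ∣ h := by
    exact_mod_cast Int.gcd_dvd_left (h : ℤ) p
  have hg0 : (Int.gcd (h : ℤ) p : ℂ) ≠ 0 := by exact_mod_cast hg.ne'
  rw [hε, charpoly_blockCompanion_smul_twistedShift_zpow hh hd (Complex.exp_ne_zero _)
    (Complex.exp_ne_zero _), ← Complex.exp_int_mul, ← Complex.exp_add, ← Complex.exp_nat_mul,
    Nat.cast_div hgh hg0]
  congr 4
  field_simp
  ring
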